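/- Let (u₁,…,u_d) be an orthonormal basis of ℝ^d, λ_{c,1},…,λ_{c,d} ≥ 0 and λ_{uc,1},…,λ_{uc,d} ≥ 0, μ_c, μ_uc, x_T ∈ ℝ^d, γ ∈ ℝ, and σ_T > 0. For σ ∈ (0, σ_T] define x(σ) = μ_c + Σ_{k=1}^d h_k(σ)^{γ/2}·√((λ_{c,k}+σ²)/(λ_{c,k}+σ_T²))·⟨u_k, x_T−μ_c⟩·u_k + γ·Σ_{k=1}^d b_k(σ)·⟨u_k, μ_c−μ_uc⟩·u_k, where h_k(σ) = ((λ_{c,k}+σ²)(λ_{uc,k}+σ_T²))/((λ_{c,k}+σ_T²)(λ_{uc,k}+σ²)) and b_k(σ) = (λ_{c,k}+σ²)^{1/2}·((λ_{c,k}+σ²)/(λ_{uc,k}+σ²))^{γ/2}·∫_σ^{σ_T}(λ_{uc,k}+s²)^{γ/2−1}(λ_{c,k}+s²)^{−(γ+1)/2}·s ds. Then x(σ_T) = x_T and, for every σ ∈ (0, σ_T], x is differentiable at σ with x′(σ) = (1/σ)(I − S_c(σ))(x(σ)−μ_c) − (γ/σ)(S_c(σ)−S_uc(σ))(x(σ)−μ_c)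 − (γ/σ)(I − S_uc(σ))(μ_c−μ_uc), where S_c(σ) = Σ_k (λ_{c,k}/(λ_{c,k}+σ²)) u_k u_kᵀ and S_uc(σ) = Σ_k (λ_{uc,k}/(λ_{uc,k}+σ²)) u_k u_kᵀ. -/

import Mathlib

open intervalIntegral in
theorem hasDerivAt_integral_left_of_continuousOn_Ioi {f : ℝ → ℝ} {a c : ℝ}
    (hf : ContinuousOn f (Set.Ioi 0)) (ha : 0 < a) (hc : 0 < c) :
    HasDerivAt (fun t => ∫ s in t..c, f s) (-f a) a := by
  refine integral_hasDerivAt_left ?_ ?_ (hf.continuousAt (Ioi_mem_nhds ha))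
  · refine (hf.mono fun s hs => ?_).intervalIntegrable
    exact lt_of_lt_of_le (lt_min ha hc) hs.1
  · exact hf.stronglyMeasurableAtFilter isOpen_Ioi a ha

theorem sum_coeff_smul_of_orthonormal {d : ℕ} {u : Fin d → Fin d → ℝ}
    (hu : ∀ i j, (∑ k, u i k * u j k) = if i = j then (1 : ℝ) else 0) (v : Fin d → ℝ) :
    ∑ k, (∑ j, u k j * v j) • u k = v := by
  have h1 : (Matrix.of u) * (Matrix.of u).transpose = 1 := by
    ext i j
    simp [Matrix.mul_apply, hu, Matrix.one_apply]
  have h2 := congrArg (fun M => Matrix.mulVec M v) (mul_eq_one_comm.mp h1)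
  simp only [Matrix.one_mulVec, ← Matrix.mulVec_mulVec] at h2
  conv_rhs => rw [← h2]
  ext i
  simp [Matrix.mulVec, dotProduct, Finset.sum_apply, mul_comm]

theorem coeff_sum_smul_of_orthonormal {d : ℕ} {u : Fin d → Fin d → ℝ}
    (hu : ∀ i j, (∑ k, u i k * u j k) = if i = j then (1 : ℝ) else 0) (c : Fin d → ℝ)
    (k : Fin d) : ∑ j, u k j * (∑ i, c i • u i) j = c k := by
  simp only [Finset.sum_apply, Pi.smul_apply, smul_eq_mul, Finset.mul_sum]
  rw [Finset.sum_comm]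
  calc ∑ i, ∑ j, u k j * (c i * u i j) = ∑ i, c i * ∑ j, u k j * u i j := by
        simp only [Finset.mul_sum]
        exact Finset.sum_congr rfl fun i _ => Finset.sum_congr rfl fun j _ => by ring
    _ = c k := by simp [hu]

/-- The solution of the homogeneous scalar equation along one common eigendirection. -/
noncomputable def guidanceWeight (lc lu γ σ : ℝ) : ℝ :=
  (lc + σ ^ 2) ^ ((1 : ℝ) / 2) * ((lc + σ ^ 2) / (lu + σ ^ 2)) ^ (γ / 2)

theorem guidanceWeight_pos {lc lu σ : ℝ} (γ : ℝ) (hlc : 0 ≤ lc) (hlu : 0 ≤ lu) (hσ : 0 < σ) :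
    0 < guidanceWeight lc lu γ σ := by
  unfold guidanceWeight
  positivity

theorem hasDerivAt_guidanceWeight {lc lu σ : ℝ} (γ : ℝ) (hlc : 0 ≤ lc) (hlu : 0 ≤ lu)
    (hσ : 0 < σ) :
    HasDerivAt (guidanceWeight lc lu γ)
      ((σ / (lc + σ ^ 2) + γ * σ / (lc + σ ^ 2) - γ * σ / (lu + σ ^ 2)) *
        guidanceWeight lc lu γ σ) σ := by
  have hC : 0 < lc + σ ^ 2 := by positivity
  have hU : 0 < lu + σ ^ 2 := by positivity
  have dsq (l : ℝ) : HasDerivAt (fun s : ℝ => l + s ^ 2) (2 * σ) σ := by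
    simpa using (hasDerivAt_pow 2 σ).const_add l
  have key := ((dsq lc).rpow_const (p := (1 : ℝ) / 2) (Or.inl hC.ne')).mul
    (((dsq lc).div (dsq lu) hU.ne').rpow_const (p := γ / 2) (Or.inl (div_pos hC hU).ne'))
  refine key.congr_deriv ?_
  simp only [guidanceWeight, Pi.div_apply]
  rw [Real.rpow_sub_one hC.ne', Real.rpow_sub_one (div_pos hC hU).ne']
  field_simp
  ring

theorem guidanceWeight_mul_integrand {lc lu σ : ℝ} (γ : ℝ) (hlc : 0 ≤ lc) (hlu : 0 ≤ lu)
    (hσ : 0 < σ) :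
    guidanceWeight lc lu γ σ *
      ((lu + σ ^ 2) ^ (γ / 2 - 1) * (lc + σ ^ 2) ^ (-(γ + 1) / 2) * σ) = σ / (lu + σ ^ 2) := by
  have hC : 0 < lc + σ ^ 2 := by positivity
  have hU : 0 < lu + σ ^ 2 := by positivity
  rw [guidanceWeight, Real.rpow_sub_one hU.ne', Real.div_rpow hC.le hU.le,
    show -(γ + 1) / 2 = -((1 : ℝ) / 2 + γ / 2) by ring, Real.rpow_neg hC.le, Real.rpow_add hC]
  have := Real.rpow_pos_of_pos hC (1 / 2)
  have := Real.rpow_pos_of_pos hC (γ / 2)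
  have := Real.rpow_pos_of_pos hU (γ / 2)
  field_simp

theorem rpow_mul_sqrt_eq_guidanceWeight_div {lc lu σT : ℝ} (γ σ : ℝ) (hlc : 0 ≤ lc)
    (hlu : 0 ≤ lu) (hσT : 0 < σT) :
    (((lc + σ ^ 2) * (lu + σT ^ 2)) / ((lc + σT ^ 2) * (lu + σ ^ 2))) ^ (γ / 2) *
        Real.sqrt ((lc + σ ^ 2) / (lc + σT ^ 2)) =
      guidanceWeight lc lu γ σ / guidanceWeight lc lu γ σT := by
  have hC : 0 ≤ lc + σ ^ 2 := by positivity
  have hU : 0 ≤ lu + σ ^ 2 := by positivity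
  have hCT : 0 ≤ lc + σT ^ 2 := by positivity
  have hUT : 0 ≤ lu + σT ^ 2 := by positivity
  have hsplit : ((lc + σ ^ 2) * (lu + σT ^ 2)) / ((lc + σT ^ 2) * (lu + σ ^ 2)) =
      ((lc + σ ^ 2) / (lu + σ ^ 2)) / ((lc + σT ^ 2) / (lu + σT ^ 2)) := by
    rw [div_div_div_eq, mul_comm (lu + σ ^ 2)]
  rw [hsplit, Real.div_rpow (div_nonneg hC hU) (div_nonneg hCT hUT), Real.sqrt_eq_rpow,
    Real.div_rpow hC hCT, guidanceWeight, guidanceWeight, div_mul_div_comm, mul_comm,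
    mul_comm (((lc + σT ^ 2) / (lu + σT ^ 2)) ^ (γ / 2))]

theorem hasDerivAt_guidanceWeight_mul_integral {lc lu σ σT : ℝ} (γ : ℝ) (hlc : 0 ≤ lc)
    (hlu : 0 ≤ lu) (hσ : 0 < σ) (hσT : 0 < σT) :
    HasDerivAt (fun t => guidanceWeight lc lu γ t *
        ∫ s in t..σT, (lu + s ^ 2) ^ (γ / 2 - 1) * (lc + s ^ 2) ^ (-(γ + 1) / 2) * s)
      ((σ / (lc + σ ^ 2) + γ * σ / (lc + σ ^ 2) - γ * σ / (lu + σ ^ 2)) *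
        (guidanceWeight lc lu γ σ *
          ∫ s in σ..σT, (lu + s ^ 2) ^ (γ / 2 - 1) * (lc + s ^ 2) ^ (-(γ + 1) / 2) * s) -
        σ / (lu + σ ^ 2)) σ := by
  have hcont : ContinuousOn
      (fun s : ℝ => (lu + s ^ 2) ^ (γ / 2 - 1) * (lc + s ^ 2) ^ (-(γ + 1) / 2) * s)
      (Set.Ioi 0) := by
    have aux (l p : ℝ) (hl : 0 ≤ l) :
        ContinuousOn (fun s : ℝ => (l + s ^ 2) ^ p) (Set.Ioi 0) := by
      refine ContinuousOn.rpow_const (by fun_prop) fun s hs => Or.inl ?_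
      have : 0 < s := hs
      positivity
    exact ((aux lu _ hlu).mul (aux lc _ hlc)).mul continuousOn_id
  refine ((hasDerivAt_guidanceWeight γ hlc hlu hσ).mul
    (hasDerivAt_integral_left_of_continuousOn_Ioi hcont hσ hσT)).congr_deriv ?_
  rw [mul_neg, guidanceWeight_mul_integrand γ hlc hlu hσ]
  ring


/-- **Closed-form solution of the CFG-guided linear reverse diffusion ODE**
(the paper's main theorem, under the Common Principal Components assumption).
With a common orthonormal eigenbasis `(u_k)`, conditional/unconditional eigenvalues
`λ_{c,k}, λ_{uc,k} ≥ 0`, means `μ_c, μ_uc`, guidance strength `γ` and initial noise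
level `σ_T`, the curve
`x(σ) = μ_c + Σ_k h_k(σ)^{γ/2}√((λ_{c,k}+σ²)/(λ_{c,k}+σ_T²))⟨u_k, x_T−μ_c⟩u_k
       + γ Σ_k b_k(σ)⟨u_k, μ_c−μ_uc⟩u_k`
satisfies `x(σ_T) = x_T` and solves
`x′(σ) = (1/σ)(I−S_c(σ))(x(σ)−μ_c) − (γ/σ)(S_c(σ)−S_uc(σ))(x(σ)−μ_c)
       − (γ/σ)(I−S_uc(σ))(μ_c−μ_uc)` on `(0, σ_T]`. -/
theorem cfg_guided_linear_reverse_ode_solution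
    {d : ℕ} (u : Fin d → (Fin d → ℝ))
    (hu : ∀ i j, (∑ k, u i k * u j k) = if i = j then (1 : ℝ) else 0)
    (lamc lamuc : Fin d → ℝ) (hlamc : ∀ k, 0 ≤ lamc k) (hlamuc : ∀ k, 0 ≤ lamuc k)
    (μc μuc xT : Fin d → ℝ) (γ : ℝ) (σT : ℝ) (hσT : 0 < σT)
    (h : Fin d → ℝ → ℝ)
    (hh : ∀ k σ, h k σ =
      ((lamc k + σ ^ 2) * (lamuc k + σT ^ 2)) /
        ((lamc k + σT ^ 2) * (lamuc k + σ ^ 2)))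
    (b : Fin d → ℝ → ℝ)
    (hb : ∀ k σ, b k σ =
      (lamc k + σ ^ 2) ^ ((1 : ℝ) / 2) *
        ((lamc k + σ ^ 2) / (lamuc k + σ ^ 2)) ^ (γ / 2) *
        ∫ s in σ..σT,
          (lamuc k + s ^ 2) ^ (γ / 2 - 1) * (lamc k + s ^ 2) ^ (-(γ + 1) / 2) * s)
    (Sc Suc : ℝ → (Fin d → ℝ) → (Fin d → ℝ))
    (hSc : ∀ σ v, Sc σ v = ∑ k, ((lamc k / (lamc k + σ ^ 2)) * ∑ j, u k j * v j) • u k)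
    (hSuc : ∀ σ v, Suc σ v = ∑ k, ((lamuc k / (lamuc k + σ ^ 2)) * ∑ j, u k j * v j) • u k)
    (x : ℝ → (Fin d → ℝ))
    (hx : ∀ σ : ℝ, x σ = μc
      + (∑ k, (h k σ ^ (γ / 2) * Real.sqrt ((lamc k + σ ^ 2) / (lamc k + σT ^ 2)) *
          (∑ j, u k j * (xT j - μc j))) • u k)
      + γ • ∑ k, (b k σ * (∑ j, u k j * (μc j - μuc j))) • u k) :
    x σT = xT ∧
      ∀ σ : ℝ, σ ∈ Set.Ioc 0 σT →
        HasDerivAt x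
          ((1 / σ) • ((x σ - μc) - Sc σ (x σ - μc))
            - (γ / σ) • (Sc σ (x σ - μc) - Suc σ (x σ - μc))
            - (γ / σ) • ((μc - μuc) - Suc σ (μc - μuc))) σ := by
  set w : Fin d → ℝ → ℝ := fun k => guidanceWeight (lamc k) (lamuc k) γ with hw
  set m : Fin d → ℝ := fun k => ∑ j, u k j * (μc j - μuc j) with hm
  set a : Fin d → ℝ := fun k => ∑ j, u k j * (xT j - μc j) with ha
  set y : Fin d → ℝ → ℝ := fun k σ => w k σ / w k σT * a k + γ * (b k σ * m k) with hy
  have hx' : ∀ σ, x σ = μc + ∑ k, y k σ • u k := by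
    intro σ
    rw [hx, add_assoc, Finset.smul_sum, ← Finset.sum_add_distrib]
    congr 1
    refine Finset.sum_congr rfl fun k _ => ?_
    rw [hh, rpow_mul_sqrt_eq_guidanceWeight_div γ σ (hlamc k) (hlamuc k) hσT, smul_smul,
      ← add_smul]
  refine ⟨?_, ?_⟩
  · have hyT : ∀ k, y k σT = ∑ j, u k j * (xT - μc) j := by
      intro k
      have hne : w k σT ≠ 0 := (guidanceWeight_pos γ (hlamc k) (hlamuc k) hσT).ne'
      simp [hy, hb, hne, ha]
    rw [hx']
    simp only [hyT]
    rw [sum_coeff_smul_of_orthonormal hu, add_sub_cancel]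
  · rintro σ ⟨hσ, -⟩
    have hyd : ∀ k, HasDerivAt (y k)
        ((σ / (lamc k + σ ^ 2) + γ * σ / (lamc k + σ ^ 2) - γ * σ / (lamuc k + σ ^ 2)) * y k σ -
          γ * (σ / (lamuc k + σ ^ 2) * m k)) σ := by
      intro k
      have hbk : b k = fun t => w k t * ∫ s in t..σT,
          (lamuc k + s ^ 2) ^ (γ / 2 - 1) * (lamc k + s ^ 2) ^ (-(γ + 1) / 2) * s :=
        funext (hb k)
      have hbd := hasDerivAt_guidanceWeight_mul_integral γ (hlamc k) (hlamuc k) hσ hσT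
      have hbσ := congrFun hbk σ
      change HasDerivAt (fun t => w k t * _) (_ * (w k σ * _) - _) σ at hbd
      rw [← hbk, ← hbσ] at hbd
      refine ((((hasDerivAt_guidanceWeight γ (hlamc k) (hlamuc k) hσ).div_const
        (w k σT)).mul_const (a k)).add ((hbd.mul_const (m k)).const_mul γ)).congr_deriv ?_
      simp only [hy, hw]
      ring
    have hxd : HasDerivAt x (∑ k,
        ((σ / (lamc k + σ ^ 2) + γ * σ / (lamc k + σ ^ 2) - γ * σ / (lamuc k + σ ^ 2)) * y k σ -
          γ * (σ / (lamuc k + σ ^ 2) * m k)) • u k) σ := by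
      rw [funext hx']
      exact (HasDerivAt.fun_sum fun k _ => (hyd k).smul_const (u k)).const_add μc
    refine hxd.congr_deriv ?_
    have hxσ : x σ - μc = ∑ k, y k σ • u k := by rw [hx', add_sub_cancel_left]
    have hμ : μc - μuc = ∑ k, m k • u k :=
      (sum_coeff_smul_of_orthonormal hu (μc - μuc)).symm
    simp only [hxσ, hμ, hSc, hSuc, coeff_sum_smul_of_orthonormal hu, ← Finset.sum_sub_distrib,
      Finset.smul_sum, ← sub_smul, smul_smul]
    refine Finset.sum_congr rfl fun k _ => ?_
    congr 1
    have hC : 0 < lamc k + σ ^ 2 := add_pos_of_nonneg_of_pos (hlamc k) (by positivity)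
    have hU : 0 < lamuc k + σ ^ 2 := add_pos_of_nonneg_of_pos (hlamuc k) (by positivity)
    field_simp
    ring
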